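/- Let p ≥ 2 and q ≥ 1. For every z = (x,y) ∈ M₀ and all U, V ∈ ℝ^{p+q}, the Ricci tensor and scalar curvature of g satisfy Ric_z(U, V) = −α(α+2)(p−2)(α+1)^{-2} |x|^{-2(α+1)} g_z(U_S, V_S) and Scal_z = −α(α+2)(p−2)(p−1)(α+1)^{-2} |x|^{-2(α+1)}, where U_S, V_S denote the g-orthogonal projections onto the vertical subspace T_z S. -/

import Mathlib

noncomputable section

open scoped RealInnerProductSpace

/-- Points/tangent vectors of `M = ℝ^p × ℝ^q` with Euclidean norms on the factors. -/
abbrev GVec (p q : ℕ) := EuclideanSpace ℝ (Fin p) × EuclideanSpace ℝ (Fin q)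

/-- The set `M₀ = (ℝ^p \ {0}) × ℝ^q`. -/
def GM0 (p q : ℕ) : Set (GVec p q) := {z | z.1 ≠ 0}

/-- Homogeneous norm `‖(x,y)‖ = (|x|^{2(α+1)} + |y|²)^{1/(2(α+1))}`. -/
def homNorm (α : ℝ) (p q : ℕ) (z : GVec p q) : ℝ :=
  (‖z.1‖ ^ (2 * (α + 1)) + ‖z.2‖ ^ 2) ^ (1 / (2 * (α + 1)))

/-- Anisotropic dilation `δ_t(x,y) = (t x, t^{α+1} y)`. -/
def gdil (α : ℝ) (p q : ℕ) (t : ℝ) (z : GVec p q) : GVec p q :=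
  (t • z.1, (t ^ (α + 1)) • z.2)

/-- Grushin inversion `Φ(z) = δ_{‖z‖^{-2}} z = (x/‖z‖², y/‖z‖^{2(α+1)})`. -/
def ginv (α : ℝ) (p q : ℕ) (z : GVec p q) : GVec p q :=
  ((homNorm α p q z ^ (-(2:ℝ))) • z.1, (homNorm α p q z ^ (-(2 * (α + 1)))) • z.2)

/-- The Riemannian metric `g = (α+1)²|x|^{2α}|dx|² + |dy|²` (depends on the point through `x`). -/
def gMet (α : ℝ) (p q : ℕ) (x : EuclideanSpace ℝ (Fin p)) (U V : GVec p q) : ℝ :=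
  (α + 1) ^ 2 * ‖x‖ ^ (2 * α) * ⟪U.1, V.1⟫ + ⟪U.2, V.2⟫

/-- The Riemannian metric `ĝ = |dx|² + |dy|²/((α+1)²|x|^{2α})`. -/
def ghat (α : ℝ) (p q : ℕ) (x : EuclideanSpace ℝ (Fin p)) (U V : GVec p q) : ℝ :=
  ⟪U.1, V.1⟫ + ⟪U.2, V.2⟫ / ((α + 1) ^ 2 * ‖x‖ ^ (2 * α))

/-- Contraction `Γ(U,V)^k = Γ^k_{ij}U^iV^j` of the Christoffel symbols
`Γ^k_{ij} = α|x|^{-2}(δ_{ik}x_j + δ_{jk}x_i − δ_{ij}x_k)` (x-indices; all other symbols zero). -/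
def gammaMap (α : ℝ) (p q : ℕ) (x : EuclideanSpace ℝ (Fin p)) (U V : GVec p q) : GVec p q :=
  ((α * ‖x‖ ^ (-(2:ℝ))) • (⟪x, V.1⟫ • U.1 + ⟪x, U.1⟫ • V.1 - ⟪U.1, V.1⟫ • x), 0)

/-- Covariant derivative `∇_U V` of a vector field `V` along the constant direction `U`, at `z`. -/
def covDeriv (α : ℝ) (p q : ℕ) (V : GVec p q → GVec p q) (z : GVec p q) (U : GVec p q) :
    GVec p q :=
  fderiv ℝ V z U + gammaMap α p q z.1 U (V z)

/-- Curvature operator `R(X,Y)Z = ∇_X ∇_Y Z − ∇_Y ∇_X Z` on constant (hence commuting) vector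
fields `X, Y, Z`, evaluated at `z`. -/
def curvOp (α : ℝ) (p q : ℕ) (z : GVec p q) (X Y Z : GVec p q) : GVec p q :=
  covDeriv α p q (fun w => gammaMap α p q w.1 Y Z) z X
    - covDeriv α p q (fun w => gammaMap α p q w.1 X Z) z Y

/-- Riemann curvature tensor `R(U,V,X,Y) = g(U, R(X,Y)V)`. -/
def riem (α : ℝ) (p q : ℕ) (z : GVec p q) (U V X Y : GVec p q) : ℝ :=
  gMet α p q z.1 U (curvOp α p q z X Y V)

/-- Ricci tensor `Ric(X,Y) = trace (V ↦ R(V,Y)X)`. -/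
def ricci (α : ℝ) (p q : ℕ) (z : GVec p q) (X Y : GVec p q) : ℝ :=
  (∑ i : Fin p, (curvOp α p q z (EuclideanSpace.single i 1, 0) Y X).1 i)
    + ∑ l : Fin q, (curvOp α p q z (0, EuclideanSpace.single l 1) Y X).2 l

/-- Scalar curvature: the `g`-trace of the Ricci tensor. -/
def scal (α : ℝ) (p q : ℕ) (z : GVec p q) : ℝ :=
  ((α + 1) ^ 2 * ‖z.1‖ ^ (2 * α))⁻¹ *
      (∑ i : Fin p, ricci α p q z (EuclideanSpace.single i 1, 0) (EuclideanSpace.single i 1, 0))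
    + ∑ l : Fin q, ricci α p q z (0, EuclideanSpace.single l 1) (0, EuclideanSpace.single l 1)

/-- The Weyl tensor
`W = R + (1/(n−2)) Ric ⊙ g − (Scal/(2(n−1)(n−2))) g ⊙ g`, where
`(h ⊙ s)(X₁,X₂,X₃,X₄) = h(X₁,X₄)s(X₂,X₃) + h(X₂,X₃)s(X₁,X₄) − h(X₁,X₃)s(X₂,X₄) − h(X₂,X₄)s(X₁,X₃)`
and `n = p + q`. -/
def weyl (α : ℝ) (p q : ℕ) (z : GVec p q) (X₁ X₂ X₃ X₄ : GVec p q) : ℝ :=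
  riem α p q z X₁ X₂ X₃ X₄
    + ((p + q : ℝ) - 2)⁻¹ *
        (ricci α p q z X₁ X₄ * gMet α p q z.1 X₂ X₃ + ricci α p q z X₂ X₃ * gMet α p q z.1 X₁ X₄
          - ricci α p q z X₁ X₃ * gMet α p q z.1 X₂ X₄
          - ricci α p q z X₂ X₄ * gMet α p q z.1 X₁ X₃)
    - scal α p q z / (2 * ((p + q : ℝ) - 1) * ((p + q : ℝ) - 2)) *
        (gMet α p q z.1 X₁ X₄ * gMet α p q z.1 X₂ X₃ + gMet α p q z.1 X₂ X₃ * gMet α p q z.1 X₁ X₄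
          - gMet α p q z.1 X₁ X₃ * gMet α p q z.1 X₂ X₄
          - gMet α p q z.1 X₂ X₄ * gMet α p q z.1 X₁ X₃)

/-- Vertical subspace `T_z S = {(v,0) : ⟨v,x⟩ = 0}`. -/
def TSp (p q : ℕ) (z : GVec p q) : Set (GVec p q) := {U | U.2 = 0 ∧ ⟪U.1, z.1⟫ = 0}

/-- Horizontal subspace `T_z H = {(t x, w) : t ∈ ℝ, w ∈ ℝ^q}`. -/
def THp (p q : ℕ) (z : GVec p q) : Set (GVec p q) := {U | ∃ t : ℝ, U.1 = t • z.1}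

/-- `g`-orthogonal projection of `U` onto the vertical subspace `T_z S`. -/
def projS (p q : ℕ) (z : GVec p q) (U : GVec p q) : GVec p q :=
  (U.1 - (⟪U.1, z.1⟫ / ‖z.1‖ ^ 2) • z.1, 0)

/-- Control (Carnot–Carathéodory) distance of the Grushin vector fields
`X_j = ∂_{x_j}`, `Y_λ = (α+1)|x|^α ∂_{y_λ}`: the infimum of `∫₀ᵀ √(|a|²+|b|²)` over absolutely
continuous admissible paths `γ̇ = Σ aⱼ Xⱼ(γ) + Σ b_λ Y_λ(γ)` joining the two points. -/
def grushinDist (α : ℝ) (p q : ℕ) (z z' : GVec p q) : ℝ :=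
  sInf { L : ℝ |
    ∃ (T : ℝ) (γ : ℝ → GVec p q) (a : ℝ → EuclideanSpace ℝ (Fin p))
      (b : ℝ → EuclideanSpace ℝ (Fin q)),
      0 ≤ T ∧ γ 0 = z ∧ γ T = z' ∧
      (∀ t ∈ Set.Icc (0:ℝ) T,
        γ t = (z.1 + ∫ s in (0:ℝ)..t, a s,
               z.2 + ∫ s in (0:ℝ)..t, ((α + 1) * ‖(γ s).1‖ ^ α) • b s)) ∧
      L = ∫ t in (0:ℝ)..T, Real.sqrt (‖a t‖ ^ 2 + ‖b t‖ ^ 2) }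

/-- `gammaMap` written without real powers. -/
lemma gammaMap_eq (α : ℝ) (p q : ℕ) (x : EuclideanSpace ℝ (Fin p)) (U V : GVec p q) :
    gammaMap α p q x U V =
      ((α * (⟪x, x⟫)⁻¹) • (⟪x, V.1⟫ • U.1 + ⟪x, U.1⟫ • V.1 - ⟪U.1, V.1⟫ • x), 0) := by
  rw [gammaMap, Real.rpow_neg (norm_nonneg x), Real.rpow_two, real_inner_self_eq_norm_sq]

lemma fderiv_gammaMap (α : ℝ) (p q : ℕ) (z : GVec p q) (hz : z.1 ≠ 0) (X Y Z : GVec p q) :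
    fderiv ℝ (fun w : GVec p q => gammaMap α p q w.1 Y Z) z X =
      ((α * (⟪z.1, z.1⟫)⁻¹) • (⟪X.1, Z.1⟫ • Y.1 + ⟪X.1, Y.1⟫ • Z.1 - ⟪Y.1, Z.1⟫ • X.1)
        - (2 * α * ⟪z.1, X.1⟫ * (⟪z.1, z.1⟫ ^ 2)⁻¹) •
          (⟪z.1, Z.1⟫ • Y.1 + ⟪z.1, Y.1⟫ • Z.1 - ⟪Y.1, Z.1⟫ • z.1), 0) := by
  have hr : ⟪z.1, z.1⟫ ≠ 0 := inner_self_ne_zero.mpr hz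
  have h1 : HasFDerivAt (fun w : GVec p q => w.1)
      (ContinuousLinearMap.fst ℝ (EuclideanSpace ℝ (Fin p)) (EuclideanSpace ℝ (Fin q))) z :=
    hasFDerivAt_fst
  have hin (v : EuclideanSpace ℝ (Fin p)) := h1.inner ℝ (hasFDerivAt_const v z)
  have hs := ((hasDerivAt_inv hr).comp_hasFDerivAt z (h1.inner ℝ h1)).const_mul α
  have hv := (((hin Z.1).smul (hasFDerivAt_const Y.1 z)).add
    ((hin Y.1).smul (hasFDerivAt_const Z.1 z))).sub (h1.const_smul ⟪Y.1, Z.1⟫)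
  have h := (hs.smul hv).prodMk (hasFDerivAt_const (0 : EuclideanSpace ℝ (Fin q)) z)
  have hfun : (fun w : GVec p q => gammaMap α p q w.1 Y Z) = fun w =>
      ((α * (⟪w.1, w.1⟫)⁻¹) • (⟪w.1, Z.1⟫ • Y.1 + ⟪w.1, Y.1⟫ • Z.1 - ⟪Y.1, Z.1⟫ • w.1), 0) :=
    funext fun w => gammaMap_eq α p q w.1 Y Z
  rw [hfun]
  refine (congrArg (fun L => L X) h.fderiv).trans ?_
  refine Prod.ext ?_ (by simp)
  simp [fderivInnerCLM_apply, real_inner_comm z.1 X.1]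
  module

lemma curvOp_eq (α : ℝ) (p q : ℕ) (z : GVec p q) (hz : z.1 ≠ 0) (X Y Z : GVec p q) :
    curvOp α p q z X Y Z =
      ((α * (α + 2) * (⟪z.1, z.1⟫)⁻¹) •
        (⟪X.1, Z.1⟫ • Y.1 - ⟪Y.1, Z.1⟫ • X.1 + (⟪z.1, z.1⟫)⁻¹ •
          ((⟪z.1, Y.1⟫ * ⟪z.1, Z.1⟫) • X.1 - (⟪z.1, X.1⟫ * ⟪z.1, Z.1⟫) • Y.1
            + (⟪z.1, X.1⟫ * ⟪Y.1, Z.1⟫ - ⟪z.1, Y.1⟫ * ⟪X.1, Z.1⟫) • z.1)), 0) := by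
  have hr : ⟪z.1, z.1⟫ ≠ 0 := inner_self_ne_zero.mpr hz
  rw [curvOp, covDeriv, covDeriv, fderiv_gammaMap α p q z hz, fderiv_gammaMap α p q z hz]
  simp only [gammaMap_eq]
  refine Prod.ext ?_ (by simp)
  simp only [Prod.fst_sub, Prod.fst_add, inner_add_right, inner_sub_right, inner_smul_right,
    real_inner_comm X.1 Y.1, real_inner_comm z.1 X.1, real_inner_comm z.1 Y.1]
  match_scalars <;> field_simp <;> ring

lemma ricci_eq (α : ℝ) (p q : ℕ) (z : GVec p q) (hz : z.1 ≠ 0) (U V : GVec p q) :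
    ricci α p q z U V = -(α * (α + 2) * ((p : ℝ) - 2) * (⟪z.1, z.1⟫)⁻¹) *
      (⟪U.1, V.1⟫ - ⟪z.1, U.1⟫ * ⟪z.1, V.1⟫ * (⟪z.1, z.1⟫)⁻¹) := by
  have hr : ⟪z.1, z.1⟫ ≠ 0 := inner_self_ne_zero.mpr hz
  have hsum (a b : EuclideanSpace ℝ (Fin p)) : ∑ i, a i * b i = ⟪a, b⟫ := by
    simp [PiLp.inner_apply, mul_comm]
  have key : ∀ i : Fin p, (curvOp α p q z (EuclideanSpace.single i 1, 0) V U).1 i =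
      (α * (α + 2) * (⟪z.1, z.1⟫)⁻¹) * (U.1 i * V.1 i - ⟪V.1, U.1⟫ + (⟪z.1, z.1⟫)⁻¹ *
        (⟪z.1, V.1⟫ * ⟪z.1, U.1⟫ - ⟪z.1, U.1⟫ * (z.1 i * V.1 i)
          + ⟪V.1, U.1⟫ * (z.1 i * z.1 i) - ⟪z.1, V.1⟫ * (U.1 i * z.1 i))) := by
    intro i
    rw [curvOp_eq α p q z hz]
    simp [EuclideanSpace.inner_single_left, EuclideanSpace.inner_single_right]
    ring
  have key2 : ∀ l : Fin q, (curvOp α p q z (0, EuclideanSpace.single l 1) V U).2 l = 0 := by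
    intro l
    rw [curvOp_eq α p q z hz]
    simp
  rw [ricci, Finset.sum_congr rfl fun i _ => key i, Finset.sum_congr rfl fun l _ => key2 l]
  simp only [← Finset.mul_sum, Finset.sum_add_distrib, Finset.sum_sub_distrib, hsum,
    Finset.sum_const, Finset.card_univ, Fintype.card_fin, nsmul_eq_mul, real_inner_comm U.1 V.1,
    real_inner_comm z.1 U.1]
  field_simp
  ring

lemma gMet_projS (α : ℝ) (p q : ℕ) (z : GVec p q) (hz : z.1 ≠ 0) (U V : GVec p q) :
    gMet α p q z.1 (projS p q z U) (projS p q z V) = (α + 1) ^ 2 * ‖z.1‖ ^ (2 * α) *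
      (⟪U.1, V.1⟫ - ⟪z.1, U.1⟫ * ⟪z.1, V.1⟫ * (⟪z.1, z.1⟫)⁻¹) := by
  have hr : ⟪z.1, z.1⟫ ≠ 0 := inner_self_ne_zero.mpr hz
  simp only [gMet, projS, ← real_inner_self_eq_norm_sq, inner_sub_left, inner_sub_right,
    inner_smul_left, inner_smul_right, inner_zero_left, real_inner_comm z.1]
  simp only [conj_trivial]
  field_simp
  ring

/-- explicit formulas for the Ricci tensor and scalar curvature of `g` on `M₀`. -/
theorem grushin_ricci_scal_formula
    (α : ℝ) (hα : 0 < α) (p q : ℕ) (hp : 2 ≤ p) (hq : 1 ≤ q)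
    (z : GVec p q) (hz : z ∈ GM0 p q) (U V : GVec p q) :
    ricci α p q z U V =
      -(α * (α + 2) * ((p : ℝ) - 2) * ((α + 1) ^ 2)⁻¹ * ‖z.1‖ ^ (-(2 * (α + 1)))) *
        gMet α p q z.1 (projS p q z U) (projS p q z V)
    ∧ scal α p q z =
      -(α * (α + 2) * ((p : ℝ) - 2) * ((p : ℝ) - 1) * ((α + 1) ^ 2)⁻¹ *
        ‖z.1‖ ^ (-(2 * (α + 1)))) := by
  have hz' : z.1 ≠ 0 := hz
  have hr : ⟪z.1, z.1⟫ ≠ 0 := inner_self_ne_zero.mpr hz'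
  have hpos : 0 < ‖z.1‖ := norm_pos_iff.mpr hz'
  have ht : ‖z.1‖ ^ (2 * α) ≠ 0 := (Real.rpow_pos_of_pos hpos _).ne'
  have hα1 : α + 1 ≠ 0 := by positivity
  have hpow : ‖z.1‖ ^ (-(2 * (α + 1))) = (‖z.1‖ ^ (2 * α))⁻¹ * (⟪z.1, z.1⟫)⁻¹ := by
    rw [Real.rpow_neg hpos.le, mul_add, mul_one, Real.rpow_add hpos, Real.rpow_two, mul_inv,
      real_inner_self_eq_norm_sq]
  constructor
  · rw [ricci_eq α p q z hz', gMet_projS α p q z hz', hpow]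
    field_simp
  · have hsum : ∑ i : Fin p, z.1 i * z.1 i = ⟪z.1, z.1⟫ := by
      rw [PiLp.inner_apply]; rfl
    have hx : ∀ i : Fin p, ricci α p q z (EuclideanSpace.single i 1, 0)
        (EuclideanSpace.single i 1, 0) = -(α * (α + 2) * ((p : ℝ) - 2) * (⟪z.1, z.1⟫)⁻¹) *
          (1 - z.1 i * z.1 i * (⟪z.1, z.1⟫)⁻¹) := by
      intro i
      rw [ricci_eq α p q z hz']
      simp [EuclideanSpace.inner_single_right]
    have hy : ∀ l : Fin q, ricci α p q z (0, EuclideanSpace.single l 1)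
        (0, EuclideanSpace.single l 1) = 0 := by
      intro l
      rw [ricci_eq α p q z hz']
      simp
    rw [scal, hpow, Finset.sum_congr rfl fun i _ => hx i, Finset.sum_congr rfl fun l _ => hy l]
    simp only [← Finset.mul_sum, ← Finset.sum_mul, Finset.sum_sub_distrib, hsum, Finset.sum_const,
      Finset.card_univ, Fintype.card_fin, nsmul_eq_mul]
    field_simp
    ring

end
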